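/- arXiv:1501.00287 — 5 statements merged into one kernel-verified Lean document; each statement's English description precedes it below -/
import Mathlib

section
/- Let D satisfy Assumption A and let G ∈ [0,1]^{n×n} be a fixed gain matrix such that no two columns of G are identical. Let η̂_{S̃} : X → Δ_n be a class-probability model learned from an i.i.d. sample S̃ of size m̃ from D, and let h_G and ĥ_G be the deterministic classifiers with [h_G(x)]_i = 1 iff i is the largest index in argmax_{y∈[n]} g_y^T η(x), and [ĥ_G(x)]_i = 1 iff i is the largest index in argmax_{y∈[n]} g_y^T η̂_{S̃}(x). If E_X[||η̂_{S̃}(X) − η(X)||_1] converges to 0 in probability as m̃ → ∞, then for every i,j ∈ [n], conf(ĥ_G, D)_{ij} converges in probability to conf(h_G, D)_{ij} as m̃ → ∞. -/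
open MeasureTheory Filter
open scoped ENNReal NNReal

noncomputable section

namespace Paper

variable {X : Type*} [MeasurableSpace X]

/-- `n × n` real matrices, as functions. -/
abbrev Mat (n : ℕ) := Fin n → Fin n → ℝ

/-- A randomized classifier: a measurable map into the probability simplex. -/
def IsClassifier {n : ℕ} (h : X → Fin n → ℝ) : Prop :=
  Measurable h ∧ ∀ x, h x ∈ stdSimplex ℝ (Fin n)

/-- Confusion matrix: `conf(h,D)_{ij} = E[h_j(X) 1(Y = i)]`. -/
def conf {n : ℕ} (h : X → Fin n → ℝ) (D : Measure (X × Fin n)) : Mat n :=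
  fun i j => ∫ z, (if z.2 = i then h z.1 j else 0) ∂D

/-- The set of feasible confusion matrices. -/
def feasibleConfs {n : ℕ} (D : Measure (X × Fin n)) : Set (Mat n) :=
  {C | ∃ h : X → Fin n → ℝ, IsClassifier h ∧ C = conf h D}

/-- Entrywise inner product of matrices. -/
def minner {n : ℕ} (A B : Mat n) : ℝ := ∑ i, ∑ j, A i j * B i j

/-- Entrywise ℓ1 norm of a matrix. -/
def l1 {n : ℕ} (A : Mat n) : ℝ := ∑ i, ∑ j, |A i j|

/-- ℓ1 distance between vectors. -/
def l1dist {n : ℕ} (p q : Fin n → ℝ) : ℝ := ∑ i, |p i - q i|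

/-- The matrix with a single `1` entry at `(i,j)`. -/
def single {n : ℕ} (i j : Fin n) : Mat n := fun k l => if k = i ∧ l = j then 1 else 0

/-- Gradient of `ψ` at `C`, as a matrix of partial derivatives. -/
def grad {n : ℕ} (ψ : Mat n → ℝ) (C : Mat n) : Mat n :=
  fun i j => fderiv ℝ ψ C (single i j)

/-- The cube `[0,1]^{n×n}`. -/
def unitCube (n : ℕ) : Set (Mat n) := {C | ∀ i j, C i j ∈ Set.Icc (0:ℝ) 1}

/-- Marginal of `D` on the instance space. -/
def marginalX {n : ℕ} (D : Measure (X × Fin n)) : Measure X := D.map Prod.fst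

/-- `η` is (a version of) the vector of conditional class probabilities under `D`. -/
def IsCondProb {n : ℕ} (D : Measure (X × Fin n)) (η : X → Fin n → ℝ) : Prop :=
  Measurable η ∧ (∀ x, η x ∈ stdSimplex ℝ (Fin n)) ∧
  ∀ (i : Fin n) (A : Set X), MeasurableSet A →
    ∫ x in A, η x i ∂(marginalX D) = (D (A ×ˢ ({i} : Set (Fin n)))).toReal

/-- The law `ν` of `η(X)`. -/
def etaLaw {n : ℕ} (D : Measure (X × Fin n)) (η : X → Fin n → ℝ) : Measure (Fin n → ℝ) :=
  (marginalX D).map η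

/-- The uniform (normalized Hausdorff) base measure on the probability simplex. -/
def uniformSimplex (n : ℕ) : Measure (Fin n → ℝ) :=
  (μH[(n : ℝ) - 1]).restrict (stdSimplex ℝ (Fin n))

/-- Assumption A: the law of `η(X)` is absolutely continuous w.r.t. the uniform
measure on the simplex. -/
def AssumptionA {n : ℕ} (D : Measure (X × Fin n)) (η : X → Fin n → ℝ) : Prop :=
  etaLaw D η ≪ uniformSimplex n

/-- Assumption B: `ψ` is continuous, differentiable and bounded over the feasible
confusion matrices, strictly increasing in diagonal entries, non-increasing in
off-diagonal entries. -/
def AssumptionB {n : ℕ} (ψ : Mat n → ℝ) (D : Measure (X × Fin n)) : Prop :=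
  ContinuousOn ψ (feasibleConfs D) ∧
  (∀ C ∈ feasibleConfs D, DifferentiableAt ℝ ψ C) ∧
  (∃ B : ℝ, ∀ C ∈ feasibleConfs D, |ψ C| ≤ B) ∧
  (∀ C ∈ unitCube n, ∀ (i : Fin n), ∀ t : ℝ, 0 < t →
      C + t • single i i ∈ unitCube n → ψ C < ψ (C + t • single i i)) ∧
  (∀ C ∈ unitCube n, ∀ (i j : Fin n), i ≠ j → ∀ t : ℝ, 0 < t →
      C + t • single i j ∈ unitCube n → ψ (C + t • single i j) ≤ ψ C)

/-- Largest index among the maximizers of `s` (ties broken towards larger indices). -/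
def argmaxIdx {n : ℕ} [NeZero n] (s : Fin n → ℝ) : Fin n := by
  classical
  exact (Finset.univ.filter fun y => ∀ y', s y' ≤ s y).max' (by
    haveI : Nonempty (Fin n) := ⟨⟨0, Nat.pos_of_ne_zero (NeZero.ne n)⟩⟩
    obtain ⟨b, hb⟩ := Finite.exists_max s
    exact ⟨b, Finset.mem_filter.mpr ⟨Finset.mem_univ _, hb⟩⟩)

/-- The scores `y ↦ g_y^T p` of the columns of a gain matrix. -/
def colScore {n : ℕ} (G : Mat n) (p : Fin n → ℝ) : Fin n → ℝ := fun y => ∑ k, G k y * p k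

/-- The scores `y ↦ (G p)_y` of the rows of a gain matrix. -/
def rowScore {n : ℕ} (G : Mat n) (p : Fin n → ℝ) : Fin n → ℝ := fun y => ∑ k, G y k * p k

/-- The plug-in (deterministic) classifier induced by gain matrix `G` on a
class-probability model `ηh`. -/
def plugIn {n : ℕ} [NeZero n] (G : Mat n) (ηh : X → Fin n → ℝ) : X → Fin n → ℝ :=
  fun x i => if i = argmaxIdx (colScore G (ηh x)) then 1 else 0

/-- The deterministic classifier `x ↦ argmax_y [G μ(x)]_y` (largest index tie-break). -/
def plugInRow {n : ℕ} [NeZero n] (G : Mat n) (f : X → Fin n → ℝ) : X → Fin n → ℝ :=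
  fun x i => if i = argmaxIdx (rowScore G (f x)) then 1 else 0

/-- Empirical measure of a finite sample. -/
def empMeasure {Z : Type*} [MeasurableSpace Z] {m : ℕ} (S : Fin m → Z) : Measure Z :=
  (m : ℝ≥0∞)⁻¹ • ∑ i : Fin m, Measure.dirac (S i)

/-- The distribution of an i.i.d. sample of size `m` from `D`. -/
def iidSample {Z : Type*} [MeasurableSpace Z] (D : Measure Z) (m : ℕ) :
    Measure (Fin m → Z) :=
  Measure.pi fun _ => D

lemma floor_split_le (a : ℝ) (ha : 0 ≤ a) (m : ℕ) : ⌊(1 - a) * (m : ℝ)⌋₊ ≤ m := by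
  calc ⌊(1 - a) * (m : ℝ)⌋₊ ≤ ⌊(m : ℝ)⌋₊ := by
        apply Nat.floor_le_floor
        nlinarith [mul_nonneg ha (Nat.cast_nonneg (α := ℝ) m)]
    _ = m := Nat.floor_natCast m

/-- First part of the sample (size `m₁`). -/
def firstPart {Z : Type*} {m : ℕ} (m₁ : ℕ) (h : m₁ ≤ m) (S : Fin m → Z) : Fin m₁ → Z :=
  fun i => S (Fin.castLE h i)

/-- Last part of the sample (size `m - m₁`). -/
def lastPart {Z : Type*} {m : ℕ} (m₁ : ℕ) (h : m₁ ≤ m) (S : Fin m → Z) :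
    Fin (m - m₁) → Z :=
  fun i => S ⟨m₁ + i.1, by have := i.2; omega⟩

/-- The first `⌊(1-a) m⌋` examples of the sample (training part `S'`). -/
def splitFirst {Z : Type*} (a : ℝ) (ha : 0 ≤ a) {m : ℕ} (S : Fin m → Z) :
    Fin ⌊(1 - a) * (m : ℝ)⌋₊ → Z :=
  firstPart _ (floor_split_le a ha m) S

/-- The remaining `m - ⌊(1-a) m⌋ = ⌈a m⌉` examples of the sample (validation part `S''`). -/
def splitLast {Z : Type*} (a : ℝ) (ha : 0 ≤ a) {m : ℕ} (S : Fin m → Z) :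
    Fin (m - ⌊(1 - a) * (m : ℝ)⌋₊) → Z :=
  lastPart _ (floor_split_le a ha m) S

/-- Expected ℓ1 estimation error of a class-probability model. -/
def cpeErr {n : ℕ} (D : Measure (X × Fin n)) (η ηh : X → Fin n → ℝ) : ℝ :=
  ∫ x, l1dist (ηh x) (η x) ∂(marginalX D)

/-- Optimal value `P*_D` of the performance metric over randomized classifiers. -/
def Pstar {n : ℕ} (ψ : Mat n → ℝ) (D : Measure (X × Fin n)) : ℝ :=
  sSup {r | ∃ h : X → Fin n → ℝ, IsClassifier h ∧ r = ψ (conf h D)}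

/-- `L`-Lipschitz with respect to the entrywise ℓ1 norm on a set of matrices. -/
def LipschitzL1On {n : ℕ} (L : ℝ) (ψ : Mat n → ℝ) (s : Set (Mat n)) : Prop :=
  ∀ C₁ ∈ s, ∀ C₂ ∈ s, |ψ C₁ - ψ C₂| ≤ L * l1 (C₁ - C₂)

/-- `β`-smooth with respect to the ℓ1 norm on a set of matrices: gradients are
`β`-Lipschitz from ℓ1 to ℓ∞. -/
def SmoothL1On {n : ℕ} (β : ℝ) (ψ : Mat n → ℝ) (s : Set (Mat n)) : Prop :=
  ∀ C₁ ∈ s, ∀ C₂ ∈ s, ∀ i j, |grad ψ C₁ i j - grad ψ C₂ i j| ≤ β * l1 (C₁ - C₂)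

/-- Largest value of a vector. -/
def top1 {n : ℕ} (v : Fin n → ℝ) : ℝ := sSup (Set.range v)

/-- Second-largest value (with multiplicity) of a vector. -/
def top2 {n : ℕ} (v : Fin n → ℝ) : ℝ :=
  sSup {r | ∃ y y', y ≠ y' ∧ r = min (v y) (v y')}

/-- One step of the BayesCG (sample-based conditional gradient) recursion:
`hs` is a run of the algorithm applied to `ψ` with `T` iterations, sample `S`
and split parameter `a`. -/
def BayesCGRun {n : ℕ} [NeZero n] (a : ℝ) (ha : 0 ≤ a) (ψ : Mat n → ℝ)
    (cpe : ∀ k : ℕ, (Fin k → X × Fin n) → X → Fin n → ℝ)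
    (m T : ℕ) (S : Fin m → X × Fin n) (hs : ℕ → X → Fin n → ℝ) : Prop :=
  IsClassifier (hs 0) ∧
  ∀ j : ℕ, 1 ≤ j → j ≤ T →
    hs j = fun x i =>
      (1 - 2 / ((j : ℝ) + 1)) * hs (j - 1) x i +
        (2 / ((j : ℝ) + 1)) *
          plugIn (grad ψ (conf (hs (j - 1)) (empMeasure (splitLast a ha S))))
            (cpe _ (splitFirst a ha S)) x i


/-! ## Statement 4 -/

lemma argmaxIdx_eq_iff {n : ℕ} [NeZero n] (s : Fin n → ℝ) (i : Fin n) :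
    i = argmaxIdx s ↔ (∀ y, s y ≤ s i) ∧ ∀ y, i < y → s y < s i := by
  classical
  unfold argmaxIdx
  rw [eq_comm, Finset.max'_eq_iff]
  simp only [Finset.mem_filter, Finset.mem_univ, true_and]
  refine and_congr_right fun h => forall_congr' fun y => ⟨fun hy hiy => ?_, fun hy hmax => ?_⟩
  · by_contra! hle
    exact absurd (hy fun y' => (h y').trans hle) (not_le.mpr hiy)
  · by_contra! hiy
    exact absurd (hmax i) (not_le.mpr (hy hiy))

lemma le_argmaxIdx {n : ℕ} [NeZero n] (s : Fin n → ℝ) (y : Fin n) : s y ≤ s (argmaxIdx s) :=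
  ((argmaxIdx_eq_iff s _).mp rfl).1 y

lemma abs_colScore_sub_le {n : ℕ} {G : Mat n} (hG : ∀ i j, G i j ∈ Set.Icc (0 : ℝ) 1)
    (p q : Fin n → ℝ) (y : Fin n) : |colScore G p y - colScore G q y| ≤ l1dist p q := by
  unfold colScore l1dist
  rw [← Finset.sum_sub_distrib]
  refine (Finset.abs_sum_le_sum_abs _ _).trans (Finset.sum_le_sum fun k _ => ?_)
  rw [← mul_sub, abs_mul, abs_of_nonneg (hG k y).1]
  exact mul_le_of_le_one_left (abs_nonneg _) (hG k y).2

lemma l1dist_nonneg {n : ℕ} (p q : Fin n → ℝ) : 0 ≤ l1dist p q :=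
  Finset.sum_nonneg fun _ _ => abs_nonneg _

lemma l1dist_le_of_mem_stdSimplex {n : ℕ} {p q : Fin n → ℝ} (hp : p ∈ stdSimplex ℝ (Fin n))
    (hq : q ∈ stdSimplex ℝ (Fin n)) : l1dist p q ≤ 2 := by
  calc l1dist p q ≤ ∑ i, (p i + q i) := Finset.sum_le_sum fun i _ => by
        rw [abs_le]; constructor <;> linarith [hp.1 i, hq.1 i]
    _ = 2 := by rw [Finset.sum_add_distrib, hp.2, hq.2]; norm_num

lemma measurable_colScore {n : ℕ} (G : Mat n) {f : X → Fin n → ℝ} (hf : Measurable f)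
    (y : Fin n) : Measurable fun x => colScore G (f x) y := by
  unfold colScore
  fun_prop

lemma measurable_l1dist {n : ℕ} {f g : X → Fin n → ℝ} (hf : Measurable f) (hg : Measurable g) :
    Measurable fun x => l1dist (f x) (g x) := by
  unfold l1dist
  refine Finset.measurable_sum _ fun i _ => ?_
  have hfi := measurable_pi_iff.mp hf i
  have hgi := measurable_pi_iff.mp hg i
  exact (hfi.sub hgi).abs

lemma measurable_plugIn {n : ℕ} [NeZero n] (G : Mat n) {f : X → Fin n → ℝ} (hf : Measurable f)
    (j : Fin n) : Measurable fun x => plugIn G f x j := by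
  refine Measurable.ite ?_ measurable_const measurable_const
  simp only [argmaxIdx_eq_iff, Set.ofPred_and, Set.ofPred_forall]
  exact (MeasurableSet.iInter fun y => measurableSet_le (measurable_colScore G hf y)
    (measurable_colScore G hf j)).inter (MeasurableSet.iInter fun y => MeasurableSet.iInter
      fun _ => measurableSet_lt (measurable_colScore G hf y) (measurable_colScore G hf j))

lemma finrank_ker_sum_prod_dot {n : ℕ} {d : Fin n → ℝ} {a b : Fin n} (hab : d a ≠ d b) :
    Module.finrank ℝ (LinearMap.ker ((Fintype.linearCombination ℝ (fun _ : Fin n => (1 : ℝ))).prod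
      (Fintype.linearCombination ℝ d))) + 2 = n := by
  classical
  set L := (Fintype.linearCombination ℝ (fun _ : Fin n => (1 : ℝ))).prod
      (Fintype.linearCombination ℝ d)
  have hne : d a - d b ≠ 0 := sub_ne_zero.mpr hab
  have hL : LinearMap.range L = ⊤ := by
    rw [LinearMap.range_eq_top]
    rintro ⟨s, t⟩
    refine ⟨Pi.single a ((t - s * d b) / (d a - d b)) +
      Pi.single b ((s * d a - t) / (d a - d b)), ?_⟩
    rw [map_add]
    simp only [L, LinearMap.prod_apply, Function.prod_apply,
      Fintype.linearCombination_apply_single, Prod.mk_add_mk, smul_eq_mul, Prod.mk.injEq]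
    constructor <;> field_simp <;> ring
  have h := L.finrank_range_add_finrank_ker
  rw [hL, finrank_top] at h
  simp at h
  omega

lemma uniformSimplex_hyperplane {n : ℕ} {d : Fin n → ℝ} (hd : d ≠ 0) :
    uniformSimplex n {p | ∑ k, d k * p k = 0} = 0 := by
  have hmeas : MeasurableSet {p : Fin n → ℝ | ∑ k, d k * p k = 0} :=
    measurableSet_eq_fun (by fun_prop) measurable_const
  rw [uniformSimplex, Measure.restrict_apply hmeas]
  set A := {p : Fin n → ℝ | ∑ k, d k * p k = 0} ∩ stdSimplex ℝ (Fin n)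
  rcases A.eq_empty_or_nonempty with hA | ⟨p₀, hp₀, hs₀⟩
  · rw [hA, measure_empty]
  obtain ⟨a, b, hab⟩ : ∃ a b, d a ≠ d b := by
    by_contra! hconst
    refine hd (funext fun a => ?_)
    have h : ∑ k, d k * p₀ k = d a := by
      simp_rw [hconst _ a, ← Finset.mul_sum, hs₀.2, mul_one]
    exact h.symm.trans hp₀
  have hrank := finrank_ker_sum_prod_dot hab
  set L := (Fintype.linearCombination ℝ (fun _ : Fin n => (1 : ℝ))).prod
      (Fintype.linearCombination ℝ d)
  let f : LinearMap.ker L → Fin n → ℝ := fun w => w + p₀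
  have hf : Isometry f := (isometry_add_right p₀).comp isometry_subtype_coe
  have hAf : A ⊆ Set.range f := by
    rintro p ⟨hp, hs⟩
    refine ⟨⟨p - p₀, ?_⟩, sub_add_cancel p p₀⟩
    have hp' : ∑ k, p k * d k = 0 := by simpa only [mul_comm] using hp.out
    have hp₀' : ∑ k, p₀ k * d k = 0 := by simpa only [mul_comm] using hp₀.out
    simp [L, Fintype.linearCombination_apply, sub_mul, hp', hp₀', hs.2, hs₀.2]
  have hdim : dimH A < ((n - 1 : ℕ) : ℝ≥0) := by
    refine (dimH_mono hAf).trans_lt ?_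
    rw [← Set.image_univ, hf.dimH_image, Real.dimH_univ_eq_finrank]
    have : Module.finrank ℝ (LinearMap.ker L) < n - 1 := by omega
    exact_mod_cast this
  have hcast : ((n : ℝ) - 1) = (((n - 1 : ℕ) : ℝ≥0) : ℝ) := by
    rw [NNReal.coe_natCast, Nat.cast_sub (by omega), Nat.cast_one]
  rw [hcast]
  exact hausdorffMeasure_of_dimH_lt hdim

lemma marginalX_tie_eq_zero {n : ℕ} {D : Measure (X × Fin n)} {η : X → Fin n → ℝ}
    (hη : Measurable η) (hA : AssumptionA D η) {G : Mat n} {y y' : Fin n}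
    (hG : (fun k => G k y) ≠ fun k => G k y') :
    marginalX D {x | colScore G (η x) y = colScore G (η x) y'} = 0 := by
  have h := hA (uniformSimplex_hyperplane (sub_ne_zero.mpr hG))
  rw [etaLaw, Measure.map_apply hη (measurableSet_eq_fun (by fun_prop) measurable_const)] at h
  refine (congrArg (marginalX D) (Set.ext fun x => ?_)).trans h
  simp [colScore, sub_mul, sub_eq_zero]

lemma tendsto_measureReal_abs_sub_le {μ : Measure X} [IsFiniteMeasure μ] {f g : X → ℝ}
    (hf : Measurable f) (hg : Measurable g) (hfg : μ {x | f x = g x} = 0) :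
    Tendsto (fun k : ℕ => μ.real {x | |f x - g x| ≤ 1 / ((k : ℝ) + 1)}) atTop (nhds 0) := by
  have hinter : ⋂ k : ℕ, {x | |f x - g x| ≤ 1 / ((k : ℝ) + 1)} = {x | f x = g x} := by
    ext x
    simp only [Set.mem_iInter, Set.mem_ofPred_eq]
    refine ⟨fun h => ?_, fun h k => by rw [h, sub_self, abs_zero]; positivity⟩
    have h0 : |f x - g x| ≤ 0 :=
      ge_of_tendsto' tendsto_one_div_add_atTop_nhds_zero_nat h
    exact sub_eq_zero.mp (abs_nonpos_iff.mp h0)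
  have h := tendsto_measure_iInter_atTop (μ := μ)
    (s := fun k : ℕ => {x | |f x - g x| ≤ 1 / ((k : ℝ) + 1)})
    (fun k => (measurableSet_le (hf.sub hg).abs measurable_const).nullMeasurableSet)
    (fun k l hkl x hx => le_trans hx.out (Nat.one_div_le_one_div hkl))
    ⟨0, measure_ne_top _ _⟩
  rw [hinter, hfg] at h
  exact (ENNReal.tendsto_toReal ENNReal.zero_ne_top).comp h

/-- The classifiers induced by `f` and `g` can only differ where two scores nearly tie, or
where `f` and `g` are far apart. -/
lemma abs_plugIn_sub_le {Z : Type*} {n : ℕ} [NeZero n] {G : Mat n}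
    (hG : ∀ i j, G i j ∈ Set.Icc (0 : ℝ) 1) (f g : Z → Fin n → ℝ) {δ : ℝ} (hδ : 0 < δ)
    (x : Z) (j : Fin n) :
    |plugIn G f x j - plugIn G g x j| ≤
      ∑ w ∈ (Finset.univ : Finset (Fin n)).offDiag,
        {x | |colScore G (g x) w.1 - colScore G (g x) w.2| ≤ δ}.indicator (fun _ => (1 : ℝ)) x
      + 2 / δ * l1dist (f x) (g x) := by
  have hind : ∀ w : Fin n × Fin n, 0 ≤
      {x | |colScore G (g x) w.1 - colScore G (g x) w.2| ≤ δ}.indicator (fun _ => (1 : ℝ)) x :=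
    fun w => Set.indicator_nonneg (fun _ _ => zero_le_one) x
  have hdist : 0 ≤ 2 / δ * l1dist (f x) (g x) := mul_nonneg (by positivity) (l1dist_nonneg _ _)
  have hle : |plugIn G f x j - plugIn G g x j| ≤ 1 := by
    unfold plugIn
    split_ifs <;> norm_num
  set y := argmaxIdx (colScore G (f x)) with hy
  set y' := argmaxIdx (colScore G (g x)) with hy'
  by_cases heq : y = y'
  · have h0 : plugIn G f x j - plugIn G g x j = 0 := by
      simp only [plugIn, ← hy, ← hy', heq, sub_self]
    rw [h0, abs_zero]
    exact add_nonneg (Finset.sum_nonneg fun w _ => hind w) hdist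
  · refine hle.trans ?_
    by_cases hgap : |colScore G (g x) y' - colScore G (g x) y| ≤ δ
    · have h := Finset.single_le_sum (fun w _ => hind w)
        (show (y', y) ∈ (Finset.univ : Finset (Fin n)).offDiag by simp [Ne.symm heq])
      rw [Set.indicator_of_mem (by exact hgap)] at h
      linarith
    · have h1 := abs_le.mp (abs_colScore_sub_le hG (f x) (g x) y)
      have h2 := abs_le.mp (abs_colScore_sub_le hG (f x) (g x) y')
      have h3 := le_argmaxIdx (colScore G (f x)) y'
      have h4 := le_argmaxIdx (colScore G (g x)) y
      rw [abs_of_nonneg (sub_nonneg.mpr h4)] at hgap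
      have h5 : 1 ≤ 2 / δ * l1dist (f x) (g x) := by
        rw [div_mul_eq_mul_div, le_div_iff₀ hδ]
        linarith
      have h6 := Finset.sum_nonneg (s := (Finset.univ : Finset (Fin n)).offDiag)
        fun w _ => hind w
      linarith

lemma abs_conf_plugIn_sub_le {n : ℕ} [NeZero n] (D : Measure (X × Fin n))
    [IsProbabilityMeasure D] {G : Mat n} (hG : ∀ i j, G i j ∈ Set.Icc (0 : ℝ) 1)
    {f g : X → Fin n → ℝ} (hf : Measurable f) (hg : Measurable g)
    (hfs : ∀ x, f x ∈ stdSimplex ℝ (Fin n)) (hgs : ∀ x, g x ∈ stdSimplex ℝ (Fin n))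
    {δ : ℝ} (hδ : 0 < δ) (i j : Fin n) :
    |conf (plugIn G f) D i j - conf (plugIn G g) D i j| ≤
      ∑ w ∈ (Finset.univ : Finset (Fin n)).offDiag,
        (marginalX D).real {x | |colScore G (g x) w.1 - colScore G (g x) w.2| ≤ δ}
      + 2 / δ * cpeErr D g f := by
  have : IsProbabilityMeasure (marginalX D) :=
    Measure.isProbabilityMeasure_map measurable_fst.aemeasurable
  have hint : ∀ h : X → Fin n → ℝ, Measurable h →
      Integrable (fun z : X × Fin n => if z.2 = i then plugIn G h z.1 j else 0) D := by
    intro h hh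
    refine Integrable.of_bound (C := 1) (Measurable.ite
      (measurable_snd (measurableSet_singleton i))
      ((measurable_plugIn G hh j).comp measurable_fst)
      measurable_const).aestronglyMeasurable (ae_of_all _ fun z => ?_)
    unfold plugIn
    split_ifs <;> norm_num
  have hset : ∀ w : Fin n × Fin n,
      MeasurableSet {x | |colScore G (g x) w.1 - colScore G (g x) w.2| ≤ δ} := fun w =>
    measurableSet_le ((measurable_colScore G hg _).sub (measurable_colScore G hg _)).abs
      measurable_const
  have hind : ∀ w ∈ (Finset.univ : Finset (Fin n)).offDiag, Integrable
      ({x | |colScore G (g x) w.1 - colScore G (g x) w.2| ≤ δ}.indicator fun _ => (1 : ℝ))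
      (marginalX D) := fun w _ => (integrable_const 1).indicator (hset w)
  have hdist : Integrable (fun x => l1dist (f x) (g x)) (marginalX D) :=
    Integrable.of_bound (C := 2) (measurable_l1dist hf hg).aestronglyMeasurable
      (ae_of_all _ fun x => by
        rw [Real.norm_eq_abs, abs_of_nonneg (l1dist_nonneg _ _)]
        exact l1dist_le_of_mem_stdSimplex (hfs x) (hgs x))
  have hbound := (integrable_finsetSum _ hind).add (hdist.const_mul (2 / δ))
  calc |conf (plugIn G f) D i j - conf (plugIn G g) D i j|
      ≤ ∫ z, (∑ w ∈ (Finset.univ : Finset (Fin n)).offDiag,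
        {x | |colScore G (g x) w.1 - colScore G (g x) w.2| ≤ δ}.indicator (fun _ => (1 : ℝ)) z.1
        + 2 / δ * l1dist (f z.1) (g z.1)) ∂D := by
        unfold conf
        rw [← integral_sub (hint f hf) (hint g hg), ← Real.norm_eq_abs]
        refine norm_integral_le_of_norm_le (hbound.comp_measurable measurable_fst)
          (ae_of_all _ fun z => ?_)
        have h := abs_plugIn_sub_le hG f g hδ z.1 j
        split_ifs
        · exact h
        · rw [sub_zero, norm_zero]
          exact (abs_nonneg _).trans h
    _ = ∫ x, (∑ w ∈ (Finset.univ : Finset (Fin n)).offDiag,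
        {x | |colScore G (g x) w.1 - colScore G (g x) w.2| ≤ δ}.indicator (fun _ => (1 : ℝ)) x
        + 2 / δ * l1dist (f x) (g x)) ∂(marginalX D) :=
        (integral_map measurable_fst.aemeasurable hbound.aestronglyMeasurable).symm
    _ = _ := by
        rw [integral_add (integrable_finsetSum _ hind) (hdist.const_mul _),
          integral_finsetSum _ hind, integral_const_mul]
        congr 1
        refine Finset.sum_congr rfl fun w _ => ?_
        rw [integral_indicator_const _ (hset w), smul_eq_mul, mul_one]

theorem stmt4 {X : Type*} [MeasurableSpace X] {n : ℕ} [NeZero n] (hn : 2 ≤ n)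
    (D : Measure (X × Fin n)) [IsProbabilityMeasure D]
    (η : X → Fin n → ℝ) (hη : IsCondProb D η) (hA : AssumptionA D η)
    (G : Mat n) (hGrange : ∀ i j, G i j ∈ Set.Icc (0:ℝ) 1)
    (hGcols : ∀ y y' : Fin n, y ≠ y' → (fun k => G k y) ≠ (fun k => G k y'))
    (cpe : ∀ k : ℕ, (Fin k → X × Fin n) → X → Fin n → ℝ)
    (hcpe : ∀ k S', Measurable (cpe k S') ∧ ∀ x, cpe k S' x ∈ stdSimplex ℝ (Fin n))
    (hcons : ∀ ε > (0:ℝ), Tendsto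
        (fun k => iidSample D k {S' | ε ≤ cpeErr D η (cpe k S')}) atTop (nhds 0)) :
    ∀ (i j : Fin n), ∀ ε > (0:ℝ), Tendsto
      (fun k => iidSample D k
        {S' | ε ≤ |conf (plugIn G (cpe k S')) D i j - conf (plugIn G η) D i j|})
      atTop (nhds 0) := by
  intro i j ε hε
  have : IsProbabilityMeasure (marginalX D) :=
    Measure.isProbabilityMeasure_map measurable_fst.aemeasurable
  have hties := tendsto_finsetSum (Finset.univ : Finset (Fin n)).offDiag fun w hw =>
    tendsto_measureReal_abs_sub_le (measurable_colScore G hη.1 w.1)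
      (measurable_colScore G hη.1 w.2)
      (marginalX_tie_eq_zero hη.1 hA (hGcols w.1 w.2 (Finset.mem_offDiag.mp hw).2.2))
  rw [Finset.sum_const_zero] at hties
  obtain ⟨N, hN⟩ := (hties.eventually_lt_const (half_pos hε)).exists
  have hδ : 0 < 1 / ((N : ℝ) + 1) := by positivity
  set δ := 1 / ((N : ℝ) + 1)
  refine tendsto_of_tendsto_of_tendsto_of_le_of_le tendsto_const_nhds
    (hcons (ε * δ / 4) (by positivity)) (fun _ => zero_le) fun k => measure_mono fun S hS => ?_
  have h := hS.out.trans (abs_conf_plugIn_sub_le D hGrange (hcpe k S).1 hη.1 (hcpe k S).2 hη.2.1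
    hδ i j)
  have h2 : ε / 2 ≤ 2 / δ * cpeErr D η (cpe k S) := by linarith
  rw [div_mul_eq_mul_div, le_div_iff₀ hδ] at h2
  change ε * δ / 4 ≤ _
  linarith

end Paper
end
end

section
/- Let ψ : [0,1]^{n×n} → ℝ_+ be concave over C_D and β-smooth w.r.t. the ℓ1 norm over C_D. Let h^FW be the classifier produced by the idealized conditional-gradient procedure for ψ with T ≥ 1 iterations and tolerance ε > 0. Then sup_{C ∈ C_D} ψ(C) − ψ(conf(h^FW, D)) ≤ 2ε + 8β/(T+2); in particular, with T = κm iterations the ψ-regret of h^FW is at most 2ε + 8β/(κm+2). -/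
open MeasureTheory Filter
open scoped ENNReal NNReal

noncomputable section

namespace Paper

variable {X : Type*} [MeasurableSpace X]

/-! ## Statement 8 -/


lemma IsClassifier.integrable {n : ℕ} {h : X → Fin n → ℝ} (hh : IsClassifier h)
    (D : Measure (X × Fin n)) [IsFiniteMeasure D] (i j : Fin n) :
    Integrable (fun z : X × Fin n => if z.2 = i then h z.1 j else 0) D := by
  refine Integrable.of_bound (C := 1) (Measurable.aestronglyMeasurable ?_) (.of_forall fun z => ?_)
  · refine Measurable.ite (measurable_snd (measurableSet_singleton i)) ?_ measurable_const
    exact ((measurable_pi_apply j).comp hh.1).comp measurable_fst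
  · have hj := mem_Icc_of_mem_stdSimplex (hh.2 z.1) j
    split_ifs
    · rw [Real.norm_of_nonneg hj.1]
      exact hj.2
    · simp

lemma conf_mix {n : ℕ} {h u : X → Fin n → ℝ} (hh : IsClassifier h) (hu : IsClassifier u)
    (D : Measure (X × Fin n)) [IsFiniteMeasure D] (γ : ℝ) :
    conf (fun x i => (1 - γ) * h x i + γ * u x i) D
      = conf h D + γ • (conf u D - conf h D) := by
  ext i j
  have key : conf (fun x i => (1 - γ) * h x i + γ * u x i) D i j
      = (1 - γ) * conf h D i j + γ * conf u D i j := by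
    simp only [conf]
    rw [← integral_const_mul, ← integral_const_mul, ← integral_add
      ((hh.integrable D i j).const_mul _) ((hu.integrable D i j).const_mul _)]
    congr 1 with z
    split_ifs <;> simp
  rw [key]
  simp only [Pi.add_apply, Pi.smul_apply, Pi.sub_apply, smul_eq_mul]
  ring

lemma IsClassifier.mix {n : ℕ} {h u : X → Fin n → ℝ} (hh : IsClassifier h) (hu : IsClassifier u)
    {γ : ℝ} (h0 : 0 ≤ γ) (h1 : γ ≤ 1) :
    IsClassifier (fun x i => (1 - γ) * h x i + γ * u x i) :=
  ⟨(hh.1.const_smul (1 - γ)).add (hu.1.const_smul γ), fun x =>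
    convex_stdSimplex ℝ (Fin n) (hh.2 x) (hu.2 x) (sub_nonneg.2 h1) h0 (by ring)⟩

lemma l1_conf {n : ℕ} {h : X → Fin n → ℝ} (hh : IsClassifier h)
    (D : Measure (X × Fin n)) [IsProbabilityMeasure D] : l1 (conf h D) = 1 := by
  have hnn : ∀ i j, 0 ≤ conf h D i j := fun i j => integral_nonneg fun z => by
    simp only [Pi.zero_apply]
    split_ifs
    exacts [(hh.2 z.1).1 j, le_rfl]
  simp only [l1, abs_of_nonneg (hnn _ _)]
  simp only [conf]
  simp_rw [← integral_finsetSum Finset.univ fun j _ => hh.integrable D _ j]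
  rw [← integral_finsetSum _ fun i _ => integrable_finsetSum _ fun j _ => hh.integrable D i j]
  have : ∀ z : X × Fin n, (∑ i, ∑ j, if z.2 = i then h z.1 j else 0) = 1 := fun z => by
    rw [Finset.sum_comm]
    simpa using (hh.2 z.1).2
  rw [integral_congr_ae (.of_forall this)]
  simp

lemma l1_sub_le {n : ℕ} (A B : Mat n) : l1 (A - B) ≤ l1 A + l1 B := by
  simp only [l1, ← Finset.sum_add_distrib]
  exact Finset.sum_le_sum fun i _ => Finset.sum_le_sum fun j _ => abs_sub _ _

lemma l1_nonneg {n : ℕ} (A : Mat n) : 0 ≤ l1 A :=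
  Finset.sum_nonneg fun _ _ => Finset.sum_nonneg fun _ _ => abs_nonneg _

lemma l1_smul {n : ℕ} (t : ℝ) (A : Mat n) : l1 (t • A) = |t| * l1 A := by
  simp [l1, abs_mul, Finset.mul_sum]

lemma fderiv_eq_minner {n : ℕ} (ψ : Mat n → ℝ) (C V : Mat n) :
    fderiv ℝ ψ C V = minner (grad ψ C) V := by
  have hV : V = ∑ i, ∑ j, V i j • single i j := by
    ext k l
    simp [Finset.sum_apply, single, ite_and]
  conv_lhs => rw [hV]
  simp [minner, grad, mul_comm]

lemma minner_sub {n : ℕ} (G A B : Mat n) : minner G (A - B) = minner G A - minner G B := by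
  simp [minner, mul_sub, Finset.sum_sub_distrib]

lemma abs_minner_sub_le {n : ℕ} {G G' V : Mat n} {b : ℝ} (hb : ∀ i j, |G i j - G' i j| ≤ b) :
    |minner G V - minner G' V| ≤ b * l1 V := by
  simp only [minner, l1, ← Finset.sum_sub_distrib, Finset.mul_sum, ← sub_mul]
  refine (Finset.abs_sum_le_sum_abs _ _).trans (Finset.sum_le_sum fun i _ => ?_)
  refine (Finset.abs_sum_le_sum_abs _ _).trans (Finset.sum_le_sum fun j _ => ?_)
  rw [abs_mul]
  exact mul_le_mul_of_nonneg_right (hb i j) (abs_nonneg _)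

lemma hasDerivAt_line {n : ℕ} {ψ : Mat n → ℝ} {C V : Mat n} {t : ℝ}
    (hd : DifferentiableAt ℝ ψ (C + t • V)) :
    HasDerivAt (fun s : ℝ => ψ (C + s • V)) (minner (grad ψ (C + t • V)) V) t := by
  rw [← fderiv_eq_minner]
  have hl : HasDerivAt (fun s : ℝ => C + s • V) V t := by
    simpa using ((hasDerivAt_id t).smul_const V).const_add C
  exact hd.hasFDerivAt.comp_hasDerivAt t hl

/-- First-order upper bound for a concave function. -/
lemma concaveOn_sub_le_minner {n : ℕ} {ψ : Mat n → ℝ} {s : Set (Mat n)} (hc : ConcaveOn ℝ s ψ)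
    {A B : Mat n} (hA : A ∈ s) (hB : B ∈ s) (hd : DifferentiableAt ℝ ψ A) :
    ψ B - ψ A ≤ minner (grad ψ A) (B - A) := by
  have hg := hc.comp_affineMap (AffineMap.lineMap A B : ℝ →ᵃ[ℝ] Mat n)
  have hfun : ψ ∘ (AffineMap.lineMap A B : ℝ →ᵃ[ℝ] Mat n)
      = fun t : ℝ => ψ (A + t • (B - A)) := by
    ext t
    simp [AffineMap.lineMap_apply, add_comm]
  rw [hfun] at hg
  have hder := hasDerivAt_line (C := A) (V := B - A) (t := 0) (by simpa using hd)
  have := hg.slope_le_of_hasDerivAt (x := 0) (y := 1) (by simpa using hA) (by simpa using hB)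
    one_pos hder
  simpa [slope_def_field] using this

/-- Quadratic lower bound along a segment for a smooth function. -/
lemma SmoothL1On.quadratic_lower_bound {n : ℕ} {ψ : Mat n → ℝ} {s : Set (Mat n)} {β : ℝ}
    (hsm : SmoothL1On β ψ s) (hs : Convex ℝ s) (hd : ∀ C ∈ s, DifferentiableAt ℝ ψ C)
    {A B : Mat n} (hA : A ∈ s) (hB : B ∈ s) {γ : ℝ} (h0 : 0 ≤ γ) (h1 : γ ≤ 1) :
    ψ A + γ * minner (grad ψ A) (B - A) - β / 2 * γ ^ 2 * l1 (B - A) ^ 2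
      ≤ ψ (A + γ • (B - A)) := by
  set V := B - A with hV
  have hmem : ∀ t ∈ Set.Icc (0 : ℝ) 1, A + t • V ∈ s := fun t ht =>
    hs.add_smul_sub_mem hA hB ht
  have hder : ∀ t ∈ Set.Icc (0 : ℝ) 1, HasDerivAt
      (fun t : ℝ => ψ (A + t • V) - t * minner (grad ψ A) V + β / 2 * l1 V ^ 2 * t ^ 2)
      (minner (grad ψ (A + t • V)) V - minner (grad ψ A) V + β * l1 V ^ 2 * t) t := by
    intro t ht
    refine HasDerivAt.congr_deriv (((hasDerivAt_line (hd _ (hmem t ht))).sub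
      ((hasDerivAt_id t).mul_const (minner (grad ψ A) V))).add
      (((hasDerivAt_id t).pow 2).const_mul (β / 2 * l1 V ^ 2))) ?_
    simp
    ring
  have hmono := monotoneOn_of_hasDerivWithinAt_nonneg (convex_Icc (0 : ℝ) 1)
    (fun t ht => (hder t ht).continuousAt.continuousWithinAt)
    (fun t ht => (hder t (interior_subset ht)).hasDerivWithinAt) (fun t ht => by
      have ht := interior_subset ht
      have hb := abs_minner_sub_le (V := V) (hsm _ (hmem t ht) A hA)
      rw [add_sub_cancel_left, l1_smul, abs_of_nonneg ht.1] at hb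
      nlinarith [neg_abs_le (minner (grad ψ (A + t • V)) V - minner (grad ψ A) V)])
  have := hmono (Set.left_mem_Icc.2 zero_le_one) ⟨h0, h1⟩ h0
  simp only [zero_smul, add_zero] at this
  nlinarith

lemma isClassifier_const {n : ℕ} (k : Fin n) :
    IsClassifier (fun _ : X => (Pi.single k 1 : Fin n → ℝ)) :=
  ⟨measurable_const, fun _ => single_mem_stdSimplex ℝ k⟩

lemma SmoothL1On.nonneg {n : ℕ} (hn : 2 ≤ n) {D : Measure (X × Fin n)} [IsProbabilityMeasure D]
    {ψ : Mat n → ℝ} {β : ℝ} (hsm : SmoothL1On β ψ (feasibleConfs D)) : 0 ≤ β := by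
  let a : Fin n := ⟨0, by omega⟩
  let b : Fin n := ⟨1, by omega⟩
  have hab : a ≠ b := by simp [a, b]
  have hA := isClassifier_const (X := X) a
  have hB := isClassifier_const (X := X) b
  have h := hsm _ ⟨_, hA, rfl⟩ _ ⟨_, hB, rfl⟩ a a
  have hne : l1 (conf (fun _ : X => (Pi.single a 1 : Fin n → ℝ)) D
      - conf (fun _ : X => (Pi.single b 1 : Fin n → ℝ)) D) ≠ 0 := by
    intro h0
    have heq : ∀ i j, conf (fun _ : X => (Pi.single a 1 : Fin n → ℝ)) D i j
        = conf (fun _ : X => (Pi.single b 1 : Fin n → ℝ)) D i j := by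
      intro i j
      have h1 := (Finset.sum_eq_zero_iff_of_nonneg (fun i _ =>
        Finset.sum_nonneg fun j _ => abs_nonneg _)).1 h0 i (Finset.mem_univ i)
      have h2 := (Finset.sum_eq_zero_iff_of_nonneg (fun j _ => abs_nonneg _)).1 h1 j
        (Finset.mem_univ j)
      exact sub_eq_zero.1 (abs_eq_zero.1 h2)
    have hone := l1_conf hA D
    have hzero : ∀ i j, conf (fun _ : X => (Pi.single a 1 : Fin n → ℝ)) D i j = 0 := by
      intro i j
      by_cases hj : j = a
      · rw [heq]
        simp [conf, hj, hab]
      · simp [conf, hj]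
    simp [l1, hzero] at hone
  exact nonneg_of_mul_nonneg_left ((abs_nonneg _).trans h) ((l1_nonneg _).lt_of_ne' hne)

theorem stmt8 {X : Type*} [MeasurableSpace X] {n : ℕ} [NeZero n] (hn : 2 ≤ n)
    (D : Measure (X × Fin n)) [IsProbabilityMeasure D]
    (ψ : Mat n → ℝ) (hψ0 : ∀ C, 0 ≤ ψ C)
    (hconc : ConcaveOn ℝ (feasibleConfs (X := X) D) ψ)
    (hdiff : ∀ C ∈ feasibleConfs (X := X) D, DifferentiableAt ℝ ψ C)
    (β : ℝ) (hsm : SmoothL1On β ψ (feasibleConfs (X := X) D))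
    (T : ℕ) (hT : 1 ≤ T) (ε : ℝ) (hε : 0 < ε)
    (h u : ℕ → X → Fin n → ℝ)
    (h0 : IsClassifier (h 0))
    (hstep : ∀ j : ℕ, 1 ≤ j → j ≤ T →
      IsClassifier (u j) ∧
      (∀ u' : X → Fin n → ℝ, IsClassifier u' →
        minner (grad ψ (conf (h (j - 1)) D)) (conf u' D)
          ≤ minner (grad ψ (conf (h (j - 1)) D)) (conf (u j) D) + ε) ∧
      h j = fun x i =>
        (1 - 2 / ((j : ℝ) + 1)) * h (j - 1) x i + (2 / ((j : ℝ) + 1)) * u j x i) :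
    ∀ C ∈ feasibleConfs (X := X) D,
      ψ C - ψ (conf (h T) D) ≤ 2 * ε + 8 * β / ((T : ℝ) + 2) := by
  rintro C ⟨c, hc, rfl⟩
  have hβ := hsm.nonneg hn
  have hγ : ∀ j : ℕ, 1 ≤ j → 0 ≤ 2 / ((j : ℝ) + 1) ∧ 2 / ((j : ℝ) + 1) ≤ 1 := fun j hj => by
    have : (1 : ℝ) ≤ j := by exact_mod_cast hj
    exact ⟨by positivity, (div_le_one (by positivity)).2 (by linarith)⟩
  have hclass : ∀ j ≤ T, IsClassifier (h j) := by
    intro j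
    induction j with
    | zero => exact fun _ => h0
    | succ k ih =>
      intro hk
      obtain ⟨hu, -, hmix⟩ := hstep (k + 1) (by omega) hk
      rw [hmix]
      exact (ih (by omega)).mix hu (hγ _ (by omega)).1 (hγ _ (by omega)).2
  have hrec : ∀ k : ℕ, k + 1 ≤ T → ψ (conf c D) - ψ (conf (h (k + 1)) D)
      ≤ (1 - 2 / ((k : ℝ) + 2)) * (ψ (conf c D) - ψ (conf (h k) D))
        + 2 / ((k : ℝ) + 2) * ε + 2 * β * (2 / ((k : ℝ) + 2)) ^ 2 := by
    intro k hk
    obtain ⟨hu, hopt, hmix⟩ := hstep (k + 1) (by omega) hk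
    obtain ⟨hγ0, hγ1⟩ := hγ (k + 1) (by omega)
    have hcast : ((k + 1 : ℕ) : ℝ) + 1 = k + 2 := by push_cast; ring
    rw [hcast] at hmix hγ0 hγ1
    simp only [Nat.add_sub_cancel] at hopt hmix
    have hh := hclass k (by omega)
    set γ := 2 / ((k : ℝ) + 2)
    rw [hmix, conf_mix hh hu]
    have hq := hsm.quadratic_lower_bound hconc.1 hdiff ⟨_, hh, rfl⟩ ⟨_, hu, rfl⟩ hγ0 hγ1
    have hf := concaveOn_sub_le_minner hconc ⟨_, hh, rfl⟩ ⟨_, hc, rfl⟩ (hdiff _ ⟨_, hh, rfl⟩)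
    have ho := hopt c hc
    rw [minner_sub] at hq hf
    have hl : l1 (conf (u (k + 1)) D - conf (h k) D) ^ 2 ≤ 4 := by
      have := l1_sub_le (conf (u (k + 1)) D) (conf (h k) D)
      rw [l1_conf hu, l1_conf hh] at this
      nlinarith [l1_nonneg (conf (u (k + 1)) D - conf (h k) D)]
    have hl' := mul_le_mul_of_nonneg_left hl (by positivity : 0 ≤ β / 2 * γ ^ 2)
    have hfo := mul_le_mul_of_nonneg_left (hf.trans (sub_le_sub_right ho _)) hγ0
    linarith
  have hbound : ∀ k : ℕ, k + 1 ≤ T → ψ (conf c D) - ψ (conf (h (k + 1)) D)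
      ≤ ε + 8 * β / ((k : ℝ) + 3) := by
    intro k
    induction k with
    | zero =>
      intro hk
      have := hrec 0 hk
      norm_num at this ⊢
      linarith
    | succ k ih =>
      intro hk
      have hr := hrec (k + 1) hk
      push_cast at hr ⊢
      have hk0 : (0 : ℝ) ≤ k := k.cast_nonneg
      have h1 : 0 ≤ 1 - 2 / ((k : ℝ) + 1 + 2) := by
        rw [sub_nonneg, div_le_one (by positivity)]
        linarith
      refine hr.trans ((add_le_add_left (add_le_add_left
        (mul_le_mul_of_nonneg_left (ih (by omega)) h1) _) _).trans ?_)
      have hle : 8 * β * ((k + 2) / ((k : ℝ) + 3) ^ 2) ≤ 8 * β * (1 / ((k : ℝ) + 4)) := by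
        refine mul_le_mul_of_nonneg_left ?_ (by positivity)
        rw [div_le_div_iff₀ (by positivity) (by positivity)]
        nlinarith
      have he : (1 - 2 / ((k : ℝ) + 1 + 2)) * (ε + 8 * β / ((k : ℝ) + 3))
          + 2 / ((k : ℝ) + 1 + 2) * ε + 2 * β * (2 / ((k : ℝ) + 1 + 2)) ^ 2
          = ε + 8 * β * ((k + 2) / ((k : ℝ) + 3) ^ 2) := by
        rw [show (k : ℝ) + 1 + 2 = k + 3 by ring]
        field_simp
        ring
      rw [he, show (k : ℝ) + 1 + 3 = k + 4 by ring]
      rw [mul_one_div] at hle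
      linarith
  obtain ⟨k, rfl⟩ : ∃ k, T = k + 1 := ⟨T - 1, by omega⟩
  have := hbound k le_rfl
  rw [show ((k + 1 : ℕ) : ℝ) + 2 = k + 3 by push_cast; ring]
  linarith

end Paper
end
end

section
/- Let D be a probability distribution over X × [n]. For every randomized classifier h : X → Δ_n there exists a measurable function f : Δ_n → Δ_n such that conf(h, D) = conf(f∘η, D); specifically, one may take f(p) = E_X[h(X) | η(X) = p], the conditional expectation of h(X) given η(X) = p. -/
open MeasureTheory Filter
open scoped ENNReal NNReal

noncomputable section

namespace Paper

variable {X : Type*} [MeasurableSpace X]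

/-! ## Statement 13 -/


section

variable {n : ℕ}

lemma IsClassifier.measurable_apply {h : X → Fin n → ℝ} (hh : IsClassifier h) (j : Fin n) :
    Measurable fun x => h x j :=
  (measurable_pi_apply j).comp hh.1

lemma IsClassifier.integrable_apply {h : X → Fin n → ℝ} (hh : IsClassifier h)
    (μ : Measure X) [IsFiniteMeasure μ] (j : Fin n) : Integrable (fun x => h x j) μ := by
  refine Integrable.of_bound (hh.measurable_apply j).aestronglyMeasurable 1 (.of_forall fun x => ?_)
  rw [Real.norm_of_nonneg ((hh.2 x).1 j)]
  exact (mem_Icc_of_mem_stdSimplex (hh.2 x) j).2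

instance (D : Measure (X × Fin n)) [IsFiniteMeasure D] : IsFiniteMeasure (marginalX D) := by
  unfold marginalX; infer_instance

lemma IsCondProb.isClassifier {D : Measure (X × Fin n)} {η : X → Fin n → ℝ}
    (hη : IsCondProb D η) : IsClassifier η :=
  ⟨hη.1, hη.2.1⟩

/-- The sub-probability law of `X` on the event `Y = i` has density `η_i`. -/
lemma IsCondProb.map_fst_restrict {D : Measure (X × Fin n)} [IsFiniteMeasure D]
    {η : X → Fin n → ℝ} (hη : IsCondProb D η) (i : Fin n) :
    (D.restrict (Set.univ ×ˢ {i})).map Prod.fst =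
      (marginalX D).withDensity fun x => ENNReal.ofReal (η x i) := by
  ext A hA
  rw [Measure.map_apply measurable_fst hA, Measure.restrict_apply (measurable_fst hA),
    withDensity_apply _ hA, ← ofReal_integral_eq_lintegral_ofReal
      (hη.isClassifier.integrable_apply _ i).integrableOn (.of_forall fun x => (hη.2.1 x).1 i),
    hη.2.2 i A hA, ENNReal.ofReal_toReal (measure_ne_top _ _)]
  congr 1
  ext z
  simp

lemma IsCondProb.conf_apply {D : Measure (X × Fin n)} [IsFiniteMeasure D]
    {η : X → Fin n → ℝ} (hη : IsCondProb D η) {g : X → Fin n → ℝ} (hg : Measurable g)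
    (i j : Fin n) : conf g D i j = ∫ x, η x i * g x j ∂(marginalX D) := by
  have hgj : Measurable fun x => g x j := (measurable_pi_apply j).comp hg
  have hs : MeasurableSet ((Set.univ : Set X) ×ˢ ({i} : Set (Fin n))) :=
    MeasurableSet.univ.prod (measurableSet_singleton i)
  calc conf g D i j
      = ∫ z, ((Set.univ : Set X) ×ˢ ({i} : Set (Fin n))).indicator (fun z => g z.1 j) z ∂D := by
        refine integral_congr_ae (.of_forall fun z => ?_)
        simp [Set.indicator_apply]
    _ = ∫ x, g x j ∂((D.restrict (Set.univ ×ˢ {i})).map Prod.fst) := by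
        rw [integral_indicator hs, integral_map measurable_fst.aemeasurable
          hgj.aestronglyMeasurable]
    _ = ∫ x, η x i * g x j ∂(marginalX D) := by
        rw [hη.map_fst_restrict, integral_withDensity_eq_integral_toReal_smul
          (hη.isClassifier.measurable_apply i).ennreal_ofReal (by simp)]
        simp [ENNReal.toReal_ofReal ((hη.2.1 _).1 i)]

/-- A simplex-valued version of the conditional expectation of a classifier given `η`,
as a function of the value of `η`. -/
lemma IsClassifier.exists_condExp_eq_comp [NeZero n] {h : X → Fin n → ℝ} (hh : IsClassifier h)
    (μ : Measure X) [IsFiniteMeasure μ] {η : X → Fin n → ℝ} (hη : Measurable η) :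
    ∃ f : (Fin n → ℝ) → (Fin n → ℝ), Measurable f ∧ (∀ p, f p ∈ stdSimplex ℝ (Fin n)) ∧
      ∀ j, (fun x => f (η x) j) =ᵐ[μ] μ[fun x => h x j | MeasurableSpace.comap η inferInstance] := by
  classical
  have hm := hη.comap_le
  choose F hF hFη using fun j => (stronglyMeasurable_condExp (μ := μ) (f := fun x => h x j)
    (m := MeasurableSpace.comap η inferInstance)).exists_eq_measurable_comp
  have hFm : Measurable fun p j => F j p := measurable_pi_iff.2 fun j => (hF j).measurable
  have hsum : ∀ᵐ x ∂μ, ∑ j, F j (η x) = 1 := by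
    have h1 := condExp_finsetSum (s := Finset.univ) (fun j _ => hh.integrable_apply μ j)
      (MeasurableSpace.comap η inferInstance)
    have h2 : ∑ j, (fun x => h x j) = fun _ => (1 : ℝ) := by
      ext x; simpa using (hh.2 x).2
    rw [h2, condExp_const hm] at h1
    filter_upwards [h1] with x hx
    simp only [hFη, Finset.sum_apply, Function.comp_apply] at hx
    exact hx.symm
  have hnonneg : ∀ᵐ x ∂μ, ∀ j, 0 ≤ F j (η x) := by
    refine ae_all_iff.2 fun j => ?_
    have h1 : 0 ≤ᵐ[μ] μ[fun x => h x j | MeasurableSpace.comap η inferInstance] :=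
      condExp_nonneg (.of_forall fun x => (hh.2 x).1 j)
    rw [hFη j] at h1
    exact h1
  refine ⟨fun p => if (fun j => F j p) ∈ stdSimplex ℝ (Fin n) then fun j => F j p
    else Pi.single 0 1, ?_, fun p => ?_, fun j => ?_⟩
  · exact Measurable.ite (hFm (isClosed_stdSimplex ℝ (Fin n)).measurableSet) hFm measurable_const
  · dsimp only
    split_ifs with hp
    exacts [hp, single_mem_stdSimplex ℝ 0]
  · rw [hFη j]
    filter_upwards [hsum, hnonneg] with x hx1 hx0
    have hx : (fun j => F j (η x)) ∈ stdSimplex ℝ (Fin n) := ⟨hx0, hx1⟩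
    simp [hx]

end

theorem stmt13 {X : Type*} [MeasurableSpace X] {n : ℕ} (hn : 2 ≤ n)
    (D : Measure (X × Fin n)) [IsProbabilityMeasure D]
    (η : X → Fin n → ℝ) (hη : IsCondProb D η)
    (h : X → Fin n → ℝ) (hh : IsClassifier h) :
    ∃ f : (Fin n → ℝ) → (Fin n → ℝ), Measurable f ∧
      (∀ p ∈ stdSimplex ℝ (Fin n), f p ∈ stdSimplex ℝ (Fin n)) ∧
      (∀ (i : Fin n) (B : Set (Fin n → ℝ)), MeasurableSet B →
        ∫ x in η ⁻¹' B, h x i ∂(marginalX D) = ∫ p in B, f p i ∂(etaLaw D η)) ∧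
      conf h D = conf (fun x => f (η x)) D := by
  have : NeZero n := ⟨by omega⟩
  obtain ⟨f, hf, hfS, hfη⟩ := hh.exists_condExp_eq_comp (marginalX D) hη.1
  have hm := hη.1.comap_le
  refine ⟨f, hf, fun p _ => hfS p, fun i B hB => ?_, ?_⟩
  · have hfi : Measurable fun p => f p i := (measurable_pi_apply i).comp hf
    rw [etaLaw, setIntegral_map hB hfi.aestronglyMeasurable hη.1.aemeasurable,
      ← setIntegral_condExp hm (hh.integrable_apply _ i) ⟨B, hB, rfl⟩]
    exact integral_congr_ae (ae_restrict_of_ae (hfη i).symm)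
  · ext i j
    rw [hη.conf_apply hh.1, hη.conf_apply (g := fun x => f (η x)) (hf.comp hη.1)]
    have hηi : StronglyMeasurable[MeasurableSpace.comap η inferInstance] fun x => η x i :=
      ((measurable_pi_apply i).comp (comap_measurable η)).stronglyMeasurable
    have hpull := condExp_stronglyMeasurable_mul_of_bound hm hηi
      (hh.integrable_apply (marginalX D) j) 1 (.of_forall fun x => by
        rw [Real.norm_of_nonneg ((hη.2.1 x).1 i)]
        exact (mem_Icc_of_mem_stdSimplex (hη.2.1 x) i).2)
    refine (integral_condExp hm).symm.trans (integral_congr_ae ?_)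
    filter_upwards [hpull, hfη j] with x hx hx'
    rw [hx']
    exact hx

end Paper
end
end

section
/- Let D be a probability distribution over X × [n] such that ν, the law of η(X) on Δ_n, is absolutely continuous with respect to the uniform probability measure μ on Δ_n, and let G ∈ ℝ^{n×n} be such that no two columns of G are identical. For c ≥ 0, set A_c = {p ∈ Δ_n : (p^T G)_{(1)} − (p^T G)_{(2)} ≤ c} and r(c) = ν(A_c). Then: (a) r is monotonically non-decreasing on ℝ_+; (b) there exists C > 0 such that r is continuous on [0, C]; and (c) r(0) = 0. -/
open MeasureTheory Filter
open scoped ENNReal NNReal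

noncomputable section

namespace Paper

variable {X : Type*} [MeasurableSpace X]

/-! ## Statement 16 -/


/-- A codimension-one slice of the simplex by a functional that is not constant on it is null
for the uniform measure. -/
lemma uniformSimplex_slice_eq_zero {n : ℕ} (d : Fin n → ℝ) {i j : Fin n} (hij : d i ≠ d j)
    (c : ℝ) : uniformSimplex n {p | p ∈ stdSimplex ℝ (Fin n) ∧ ∑ k, d k * p k = c} = 0 := by
  refine le_antisymm ((Measure.restrict_apply_le _ _).trans (le_of_eq ?_)) zero_le
  rcases Set.eq_empty_or_nonempty
    {p : Fin n → ℝ | p ∈ stdSimplex ℝ (Fin n) ∧ ∑ k, d k * p k = c} with h | ⟨p₀, hp₀, hd₀⟩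
  · rw [h, measure_empty]
  let S : (Fin n → ℝ) →ₗ[ℝ] ℝ := ∑ k, LinearMap.proj k
  let T : (Fin n → ℝ) →ₗ[ℝ] ℝ := ∑ k, d k • LinearMap.proj k
  have hS (v : Fin n → ℝ) : S v = ∑ k, v k := by simp [S]
  have hT (v : Fin n → ℝ) : T v = ∑ k, d k * v k := by simp [T]
  have hne : i ≠ j := fun h => hij (by rw [h])
  have hker : S.ker < ⊤ := by
    refine lt_top_iff_ne_top.2 fun h => ?_
    have : Pi.single i (1 : ℝ) ∈ S.ker := h ▸ Submodule.mem_top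
    simp [hS] at this
  have hinf : S.ker ⊓ T.ker < S.ker := by
    refine inf_lt_left.2 fun h => hij ?_
    have : Pi.single i (1 : ℝ) - Pi.single j 1 ∈ T.ker := h (by simp [hS])
    have : T (Pi.single i (1 : ℝ)) - T (Pi.single j 1) = 0 := by rw [← map_sub]; exact this
    simp only [hT, Pi.single_apply, mul_ite, mul_one, mul_zero, Finset.sum_ite_eq',
      Finset.mem_univ, if_true] at this
    linarith
  have hrank : Module.finrank ℝ ↥(S.ker ⊓ T.ker) + 1 < n := by
    have h₁ := Submodule.finrank_lt_finrank_of_lt hinf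
    have h₂ := Submodule.finrank_lt hker.ne
    rw [Module.finrank_fin_fun] at h₂
    omega
  have hsub : {p : Fin n → ℝ | p ∈ stdSimplex ℝ (Fin n) ∧ ∑ k, d k * p k = c} ⊆
      Set.range fun w : ↥(S.ker ⊓ T.ker) => (w : Fin n → ℝ) + p₀ := by
    rintro p ⟨hp, hd⟩
    refine ⟨⟨p - p₀, ?_, ?_⟩, by simp⟩
    · change S (p - p₀) = 0
      rw [map_sub, hS, hS, hp.2, hp₀.2, sub_self]
    · change T (p - p₀) = 0
      rw [map_sub, hT, hT, hd, hd₀, sub_self]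
  have hlip : LipschitzWith 1 fun w : ↥(S.ker ⊓ T.ker) => (w : Fin n → ℝ) + p₀ :=
    LipschitzWith.of_edist_le fun a b => by
      rw [edist_add_right]
      exact le_rfl
  have hdim := hlip.dimH_range_le
  rw [Real.dimH_univ_eq_finrank] at hdim
  have hn : ((n - 1 : ℕ) : ℝ) = (n : ℝ) - 1 := by
    rw [Nat.cast_sub (by omega), Nat.cast_one]
  refine measure_mono_null hsub ?_
  rw [← hn]
  refine hausdorffMeasure_of_dimH_lt (d := ((n - 1 : ℕ) : ℝ≥0)) (hdim.trans_lt ?_)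
  simp only [ENNReal.coe_natCast, Nat.cast_lt]
  omega

lemma top1_eq_iSup {n : ℕ} (v : Fin n → ℝ) : top1 v = ⨆ y, v y := rfl

lemma top2_eq_iSup {n : ℕ} (v : Fin n → ℝ) :
    top2 v = ⨆ q : {q : Fin n × Fin n // q.1 ≠ q.2}, min (v q.1.1) (v q.1.2) := by
  unfold top2 iSup
  congr 1
  ext r
  constructor
  · rintro ⟨y, y', h, rfl⟩
    exact ⟨⟨(y, y'), h⟩, rfl⟩
  · rintro ⟨⟨⟨y, y'⟩, h⟩, rfl⟩
    exact ⟨y, y', h, rfl⟩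

lemma le_top1 {n : ℕ} (v : Fin n → ℝ) (y : Fin n) : v y ≤ top1 v :=
  le_ciSup (Finite.bddAbove_range v) y

lemma exists_eq_top1 {n : ℕ} (hn : 2 ≤ n) (v : Fin n → ℝ) : ∃ y, v y = top1 v := by
  have : Nonempty (Fin n) := ⟨⟨0, by omega⟩⟩
  exact exists_eq_ciSup_of_finite

lemma exists_eq_top2 {n : ℕ} (hn : 2 ≤ n) (v : Fin n → ℝ) :
    ∃ y y', y ≠ y' ∧ v y ≤ v y' ∧ v y = top2 v := by
  have : Nonempty {q : Fin n × Fin n // q.1 ≠ q.2} :=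
    ⟨⟨(⟨0, by omega⟩, ⟨1, by omega⟩), by simp⟩⟩
  obtain ⟨⟨⟨y, y'⟩, h⟩, hq⟩ := exists_eq_ciSup_of_finite
    (f := fun q : {q : Fin n × Fin n // q.1 ≠ q.2} => min (v q.1.1) (v q.1.2))
  rw [← top2_eq_iSup] at hq
  rcases le_total (v y) (v y') with hle | hle
  · exact ⟨y, y', h, hle, by rw [← hq]; exact (min_eq_left hle).symm⟩
  · exact ⟨y', y, h.symm, hle, by rw [← hq]; exact (min_eq_right hle).symm⟩

lemma top2_le_top1 {n : ℕ} (hn : 2 ≤ n) (v : Fin n → ℝ) : top2 v ≤ top1 v := by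
  obtain ⟨y, -, -, -, h⟩ := exists_eq_top2 hn v
  exact h ▸ le_top1 v y

/-- The gap between the two largest entries is a difference of two entries. -/
lemma exists_sub_eq_top1_sub_top2 {n : ℕ} (hn : 2 ≤ n) (v : Fin n → ℝ) :
    ∃ y y', y ≠ y' ∧ v y - v y' = top1 v - top2 v := by
  obtain ⟨z, hz⟩ := exists_eq_top1 hn v
  obtain ⟨y, y', hne, hle, hy⟩ := exists_eq_top2 hn v
  by_cases h : z = y
  · subst h
    have := le_top1 v y'
    exact ⟨y', z, hne.symm, by linarith⟩
  · exact ⟨z, y, h, by rw [hz, hy]⟩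

lemma measurable_gap_colScore {n : ℕ} (G : Mat n) :
    Measurable fun p => top1 (colScore G p) - top2 (colScore G p) := by
  have hs (y : Fin n) : Measurable fun p => colScore G p y := by
    unfold colScore
    fun_prop
  simp only [top1_eq_iSup, top2_eq_iSup]
  exact (Measurable.iSup hs).sub (Measurable.iSup fun q => (hs _).min (hs _))

lemma eventually_measure_colScore_sub_eq_zero {n : ℕ} {ν : Measure (Fin n → ℝ)}
    (hν : ν ≪ uniformSimplex n) (G : Mat n) {y y' : Fin n}
    (hG : (fun k => G k y) ≠ fun k => G k y') :
    ∀ᶠ c in nhds (0 : ℝ),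
      ν {p | p ∈ stdSimplex ℝ (Fin n) ∧ colScore G p y - colScore G p y' = c} = 0 := by
  have hsum (p : Fin n → ℝ) :
      colScore G p y - colScore G p y' = ∑ k, (G k y - G k y') * p k := by
    simp only [colScore, sub_mul, Finset.sum_sub_distrib]
  simp only [hsum]
  by_cases h : ∃ i j, G i y - G i y' ≠ G j y - G j y'
  · obtain ⟨i, j, hij⟩ := h
    exact .of_forall fun c =>
      hν (uniformSimplex_slice_eq_zero (fun k => G k y - G k y') hij c)
  · push Not at h
    obtain ⟨i, hi⟩ := Function.ne_iff.1 hG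
    filter_upwards [eventually_ne_nhds (sub_ne_zero.2 hi).symm] with c hc
    convert measure_empty (μ := ν)
    refine Set.eq_empty_of_forall_notMem fun p hp => hc ?_
    rw [← hp.2, Finset.sum_congr rfl fun k _ => by rw [h k i], ← Finset.mul_sum, hp.1.2, mul_one]

/-- For small `c`, the gap takes the value `c` with probability zero. -/
lemma eventually_measure_gap_eq_zero {n : ℕ} (hn : 2 ≤ n) {ν : Measure (Fin n → ℝ)}
    (hν : ν ≪ uniformSimplex n) (G : Mat n)
    (hG : ∀ y y' : Fin n, y ≠ y' → (fun k => G k y) ≠ fun k => G k y') :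
    ∀ᶠ c in nhds (0 : ℝ),
      ν {p | p ∈ stdSimplex ℝ (Fin n) ∧ top1 (colScore G p) - top2 (colScore G p) = c} = 0 := by
  have hall : ∀ᶠ c in nhds (0 : ℝ), ∀ q : {q : Fin n × Fin n // q.1 ≠ q.2},
      ν {p | p ∈ stdSimplex ℝ (Fin n) ∧ colScore G p q.1.1 - colScore G p q.1.2 = c} = 0 :=
    eventually_all.2 fun q => eventually_measure_colScore_sub_eq_zero hν G (hG _ _ q.2)
  filter_upwards [hall] with c hc
  refine measure_mono_null ?_ (measure_iUnion_null hc)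
  rintro p ⟨hp, hpc⟩
  obtain ⟨y, y', hne, h⟩ := exists_sub_eq_top1_sub_top2 hn (colScore G p)
  exact Set.mem_iUnion.2 ⟨⟨(y, y'), hne⟩, hp, h.trans hpc⟩

/-- The distribution function of `f` on `s` is continuous at every non-atom. -/
lemma continuousAt_measure_sep_le {α : Type*} [MeasurableSpace α] (ν : Measure α)
    [IsFiniteMeasure ν] {s : Set α} (hs : MeasurableSet s) {f : α → ℝ} (hf : Measurable f)
    {c : ℝ} (hc : ν {p | p ∈ s ∧ f p = c} = 0) :
    ContinuousAt (fun c : ℝ => ν {p | p ∈ s ∧ f p ≤ c}) c := by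
  have hm (a : ℝ) : MeasurableSet {p | p ∈ s ∧ f p ≤ a} :=
    hs.inter (measurableSet_le hf measurable_const)
  refine tendsto_measure_of_ae_tendsto_indicator_of_isFiniteMeasure _ (hm c) hm ?_
  filter_upwards [measure_eq_zero_iff_ae_notMem.1 hc] with p hp
  by_cases hps : p ∈ s
  · have hne : f p ≠ c := fun h => hp ⟨hps, h⟩
    rcases hne.lt_or_gt with h | h
    · filter_upwards [eventually_gt_nhds h] with a ha
      simp [hps, h.le, ha.le]
    · filter_upwards [eventually_lt_nhds h] with a ha
      simp [hps, h.not_ge, ha.not_ge]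
  · exact .of_forall fun a => by simp [hps]

theorem stmt16 {X : Type*} [MeasurableSpace X] {n : ℕ} (hn : 2 ≤ n)
    (D : Measure (X × Fin n)) [IsProbabilityMeasure D]
    (η : X → Fin n → ℝ) (hη : IsCondProb D η)
    (habs : etaLaw D η ≪ uniformSimplex n)
    (G : Mat n)
    (hGcols : ∀ y y' : Fin n, y ≠ y' → (fun k => G k y) ≠ (fun k => G k y')) :
    (∀ a b : ℝ, 0 ≤ a → a ≤ b →
        etaLaw D η {p | p ∈ stdSimplex ℝ (Fin n) ∧
            top1 (colScore G p) - top2 (colScore G p) ≤ a}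
          ≤ etaLaw D η {p | p ∈ stdSimplex ℝ (Fin n) ∧
            top1 (colScore G p) - top2 (colScore G p) ≤ b}) ∧
    (∃ C : ℝ, 0 < C ∧ ContinuousOn
        (fun c : ℝ => etaLaw D η {p | p ∈ stdSimplex ℝ (Fin n) ∧
            top1 (colScore G p) - top2 (colScore G p) ≤ c})
        (Set.Icc 0 C)) ∧
    etaLaw D η {p | p ∈ stdSimplex ℝ (Fin n) ∧
        top1 (colScore G p) - top2 (colScore G p) ≤ 0} = 0 := by
  have : IsFiniteMeasure (etaLaw D η) := by
    unfold etaLaw marginalX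
    infer_instance
  have hnull := eventually_measure_gap_eq_zero hn habs G hGcols
  refine ⟨fun a b _ hab => measure_mono fun p hp => ⟨hp.1, hp.2.trans hab⟩, ?_, ?_⟩
  · obtain ⟨ε, hε, h⟩ := Metric.eventually_nhds_iff.1 hnull
    refine ⟨ε / 2, half_pos hε, fun c hc => ContinuousAt.continuousWithinAt ?_⟩
    refine continuousAt_measure_sep_le _ (isClosed_stdSimplex ℝ (Fin n)).measurableSet
      (measurable_gap_colScore G) (h ?_)
    rw [Real.dist_eq, sub_zero, abs_of_nonneg hc.1]
    linarith [hc.2]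
  · refine measure_mono_null ?_ hnull.self_of_nhds
    exact fun p hp => ⟨hp.1, le_antisymm hp.2 (sub_nonneg.2 (top2_le_top1 hn _))⟩

end Paper
end
end

section
/- Fix an integer n ≥ 1 and ρ ∈ (0,1). Define the smoothed H-mean ψ^H_ρ : [0,1]^{n×n} → ℝ by ψ^H_ρ(C) = n·(Σ_{y=1}^n (Σ_{ŷ=1}^n C_{y,ŷ} + ρ)/(C_{y,y} + ρ))^{−1}. Then for every C ∈ [0,1]^{n×n}, every partial derivative of ψ^H_ρ at C has absolute value at most n/ρ, i.e. ||∇ψ^H_ρ(C)||_∞ ≤ n/ρ; consequently, ψ^H_ρ is (n/ρ)-Lipschitz with respect to the ℓ1 norm over [0,1]^{n×n}, i.e. |ψ^H_ρ(C₁) − ψ^H_ρ(C₂)| ≤ (n/ρ)·||C₁ − C₂||_1 for all C₁, C₂ ∈ [0,1]^{n×n}. -/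
open MeasureTheory Filter
open scoped ENNReal NNReal

noncomputable section

namespace Paper

variable {X : Type*} [MeasurableSpace X]

/-! ## Statement 19 -/


/-- The smoothed H-mean. -/
def psiH (n : ℕ) (ρ : ℝ) (C : Mat n) : ℝ :=
  n * (∑ y, (∑ z, C y z + ρ) / (C y y + ρ))⁻¹

lemma le_rowSum_of_mem_unitCube {n : ℕ} {C : Mat n} (hC : C ∈ unitCube n) (y : Fin n) :
    C y y ≤ ∑ z, C y z :=
  Finset.single_le_sum (f := C y) (fun z _ => (hC y z).1) (Finset.mem_univ y)

lemma one_le_ratio {n : ℕ} {ρ : ℝ} (hρ : 0 < ρ) {C : Mat n} (hC : C ∈ unitCube n) (y : Fin n) :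
    1 ≤ (∑ z, C y z + ρ) / (C y y + ρ) := by
  have h := (hC y y).1
  rw [one_le_div (by linarith)]
  linarith [le_rowSum_of_mem_unitCube hC y]

lemma natCast_le_sum_ratio {n : ℕ} {ρ : ℝ} (hρ : 0 < ρ) {C : Mat n} (hC : C ∈ unitCube n) :
    (n : ℝ) ≤ ∑ y, (∑ z, C y z + ρ) / (C y y + ρ) := by
  simpa using Finset.sum_le_sum fun y (_ : y ∈ Finset.univ) => one_le_ratio hρ hC y

lemma convex_unitCube (n : ℕ) : Convex ℝ (unitCube n) := by
  have h : unitCube n = Set.univ.pi fun _ => Set.univ.pi fun _ => Set.Icc (0 : ℝ) 1 := by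
    ext C
    simp only [unitCube, Set.mem_ofPred_eq, Set.mem_univ_pi]
  rw [h]
  exact convex_pi fun _ _ => convex_pi fun _ _ => convex_Icc 0 1

lemma l1_single {n : ℕ} (i j : Fin n) : l1 (single i j) = 1 := by
  simp [l1, single, apply_ite abs, ite_and]

lemma differentiableAt_psiH {n : ℕ} (hn : 1 ≤ n) {ρ : ℝ} (hρ : 0 < ρ) {C : Mat n}
    (hC : C ∈ unitCube n) : DifferentiableAt ℝ (psiH n ρ) C := by
  have hd : ∀ y, C y y + ρ ≠ 0 := fun y => (by linarith [(hC y y).1] : 0 < C y y + ρ).ne'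
  have hn' : (1 : ℝ) ≤ n := by exact_mod_cast hn
  have hS : ∑ y, (∑ z, C y z + ρ) / (C y y + ρ) ≠ 0 :=
    (by linarith [natCast_le_sum_ratio hρ hC] : (0 : ℝ) < _).ne'
  unfold psiH
  fun_prop (disch := first | exact hS | exact hd _)

/-- The numerator of the directional derivative of a single ratio. -/
lemma abs_rowSum_mul_sub_le {n : ℕ} (v : Fin n → ℝ) (y : Fin n) {d r : ℝ} (hd : 0 ≤ d)
    (hdr : d ≤ r) : |(∑ z, v z) * d - r * v y| ≤ r * ∑ z, |v z| := by
  have h1 := Finset.add_sum_erase Finset.univ v (Finset.mem_univ y)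
  have h2 := Finset.add_sum_erase Finset.univ (fun z => |v z|) (Finset.mem_univ y)
  have h3 := Finset.abs_sum_le_sum_abs v (Finset.univ.erase y)
  rw [← h1, ← h2]
  set a := ∑ z ∈ Finset.univ.erase y, v z
  calc |(v y + a) * d - r * v y| = |d * a - (r - d) * v y| := by ring_nf
    _ ≤ |d * a| + |(r - d) * v y| := abs_sub _ _
    _ = d * |a| + (r - d) * |v y| := by
        rw [abs_mul, abs_mul, abs_of_nonneg hd, abs_of_nonneg (sub_nonneg.2 hdr)]
    _ ≤ r * (|v y| + ∑ z ∈ Finset.univ.erase y, |v z|) := by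
        nlinarith [abs_nonneg (v y), abs_nonneg a, mul_le_mul hdr h3 (abs_nonneg a) (hd.trans hdr),
          mul_nonneg hd (abs_nonneg (v y))]

lemma exists_hasDerivAt_psiH_line {n : ℕ} (hn : 1 ≤ n) {ρ : ℝ} (hρ : 0 < ρ) (A V : Mat n)
    {t : ℝ} (hC : A + t • V ∈ unitCube n) :
    ∃ d, HasDerivAt (fun s : ℝ => psiH n ρ (A + s • V)) d t ∧ |d| ≤ n / ρ * l1 V := by
  set C := A + t • V with hCdef
  have hn' : (1 : ℝ) ≤ n := by exact_mod_cast hn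
  have hd : ∀ y, ρ ≤ C y y + ρ := fun y => by linarith [(hC y y).1]
  have hr : ∀ y, C y y + ρ ≤ ∑ z, C y z + ρ := fun y => by
    linarith [le_rowSum_of_mem_unitCube hC y]
  have hS := natCast_le_sum_ratio hρ hC
  have hS0 : 0 < ∑ y, (∑ z, C y z + ρ) / (C y y + ρ) := by linarith
  have hentry : ∀ y z, HasDerivAt (fun s : ℝ => (A + s • V) y z) (V y z) t := fun y z => by
    simpa using ((hasDerivAt_id t).mul_const (V y z)).const_add (A y z)
  have hratio : ∀ y, HasDerivAt
      (fun s : ℝ => (∑ z, (A + s • V) y z + ρ) / ((A + s • V) y y + ρ))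
      (((∑ z, V y z) * (C y y + ρ) - (∑ z, C y z + ρ) * V y y) / (C y y + ρ) ^ 2) t :=
    fun y => ((HasDerivAt.fun_sum fun z _ => hentry y z).add_const ρ).fun_div
      ((hentry y y).add_const ρ) (hρ.trans_le (hd y)).ne'
  have hsum := HasDerivAt.fun_sum fun y (_ : y ∈ Finset.univ) => hratio y
  refine ⟨_, (hsum.fun_inv hS0.ne').const_mul (n : ℝ), ?_⟩
  rw [← hCdef]
  set S := ∑ y, (∑ z, C y z + ρ) / (C y y + ρ) with hSdef
  have hterm : ∀ y, |((∑ z, V y z) * (C y y + ρ) - (∑ z, C y z + ρ) * V y y) / (C y y + ρ) ^ 2|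
      ≤ S / ρ * ∑ z, |V y z| := fun y => by
    have hd0 : 0 < C y y + ρ := hρ.trans_le (hd y)
    have hle : (∑ z, C y z + ρ) / (C y y + ρ) ≤ S :=
      Finset.single_le_sum (f := fun y => (∑ z, C y z + ρ) / (C y y + ρ))
        (fun y _ => zero_le_one.trans (one_le_ratio hρ hC y)) (Finset.mem_univ y)
    rw [abs_div, abs_of_pos (pow_pos hd0 2)]
    calc _ ≤ (∑ z, C y z + ρ) * (∑ z, |V y z|) / (C y y + ρ) ^ 2 := by
          gcongr
          exact abs_rowSum_mul_sub_le (V y) y hd0.le (hr y)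
      _ = (∑ z, C y z + ρ) / (C y y + ρ) / (C y y + ρ) * ∑ z, |V y z| := by
          field_simp
      _ ≤ S / ρ * ∑ z, |V y z| := by
          gcongr
          exact hd y
  have hbound := (Finset.abs_sum_le_sum_abs _ _).trans
    (Finset.sum_le_sum fun y (_ : y ∈ Finset.univ) => hterm y)
  rw [← Finset.mul_sum] at hbound
  have hl1 : 0 ≤ l1 V := Finset.sum_nonneg fun _ _ => Finset.sum_nonneg fun _ _ => abs_nonneg _
  rw [abs_mul, abs_div, abs_neg, abs_of_pos (pow_pos hS0 2), Nat.abs_cast]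
  calc _ ≤ (n : ℝ) * (S / ρ * l1 V / S ^ 2) := by
        gcongr
        exact hbound
    _ = n / ρ * l1 V / S := by field_simp
    _ ≤ n / ρ * l1 V := div_le_self (by positivity) (hn'.trans hS)

theorem stmt19 (n : ℕ) (hn : 1 ≤ n) (ρ : ℝ) (hρ : ρ ∈ Set.Ioo (0:ℝ) 1) :
    (∀ C ∈ unitCube n, ∀ i j, |grad (psiH n ρ) C i j| ≤ n / ρ) ∧
      (∀ C₁ ∈ unitCube n, ∀ C₂ ∈ unitCube n,
        |psiH n ρ C₁ - psiH n ρ C₂| ≤ (n / ρ) * l1 (C₁ - C₂)) := by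
  have hρ0 : 0 < ρ := hρ.1
  refine ⟨fun C hC i j => ?_, fun C₁ h₁ C₂ h₂ => ?_⟩
  · obtain ⟨d, hd, hbound⟩ := exists_hasDerivAt_psiH_line hn hρ0 C (single i j) (t := 0)
      (by simpa using hC)
    have h := (differentiableAt_psiH hn hρ0 hC).hasFDerivAt.hasLineDerivAt (single i j)
    rw [l1_single, mul_one] at hbound
    rwa [grad, HasDerivAt.unique h hd]
  · have hmem : ∀ t ∈ Set.Icc (0 : ℝ) 1, C₂ + t • (C₁ - C₂) ∈ unitCube n := fun t ht =>
      (convex_unitCube n).add_smul_sub_mem h₂ h₁ ht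
    choose! f' hf' hbound using fun t ht =>
      exists_hasDerivAt_psiH_line hn hρ0 C₂ (C₁ - C₂) (hmem t ht)
    simpa using (convex_Icc (0 : ℝ) 1).norm_image_sub_le_of_norm_hasDerivWithin_le
      (fun t ht => (hf' t ht).hasDerivWithinAt) hbound
      (Set.left_mem_Icc.2 zero_le_one) (Set.right_mem_Icc.2 zero_le_one)

end Paper
end
end
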